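/- arXiv:2210.00078 — 2 statements merged into one kernel-verified Lean document; each statement's English description precedes it below -/
import Mathlib

section
/- The mates correspondence is functorial with respect to both vertical and horizontal pasting of squares (Kelly–Street). Vertically: given adjunctions F₁ ⊣ U₁ (between 𝒜 and ℬ), F₂ ⊣ U₂ (between ℬ and 𝒞), L₁ ⊣ R₁ (between 𝒟 and ℰ), L₂ ⊣ R₂ (between ℰ and ℱ), functors H : 𝒜 → 𝒟, K : ℬ → ℰ, M : 𝒞 → ℱ, and natural transformations α₁ : L₁ ∘ H ⇒ K ∘ F₁ and α₂ : L₂ ∘ K ⇒ M ∘ F₂, the mate of the vertical pasting (α₂ whiskered with F₁) ∘ (L₂ whiskered with α₁) : L₂L₁H ⇒ MF₂F₁, taken with respect to the composite adjunctions F₂F₁ ⊣ U₁U₂ and L₂L₁ ⊣ R₁R₂, equals the vertical pasting (R₁ whiskered with β₂) ∘ (β₁ whiskered with U₂) : HU₁U₂ ⇒ R₁R₂M of the mates β₁ of α₁ and β₂ of α₂. Horizontally: given adjunctions F ⊣ U (between 𝒜 and ℬ), L ⊣ R (between 𝒞 and 𝒟), G ⊣ V (between ℰ and ℱ), functors H :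 𝒜 → 𝒞, K : ℬ → 𝒟, H′ : 𝒞 → ℰ, K′ : 𝒟 → ℱ, and natural transformations α : L ∘ H ⇒ K ∘ F and α′ : G ∘ H′ ⇒ K′ ∘ L, the mate of the horizontal pasting (K′ whiskered with α) ∘ (α′ whiskered with H) : GH′H ⇒ K′KF, taken with respect to F ⊣ U and G ⊣ V, equals the horizontal pasting (β′ whiskered with K) ∘ (H′ whiskered with β) : H′HU ⇒ VK′K of the mates β of α and β′ of α′. -/
/-!
Kelly–Street: the mates correspondence is functorial with respect to vertical and
horizontal pasting of squares.
-/

open CategoryTheory Category Functor Adjunction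

universe v₁ v₂ v₃ v₄ v₅ v₆ u₁ u₂ u₃ u₄ u₅ u₆

/-- Horizontal composition of 2-squares as a composite of whiskerings. -/
theorem hComp_eq_whiskerLeft_comp_whiskerRight
    {A : Type u₁} {B : Type u₂} {C : Type u₃} {D : Type u₄} {E : Type u₅} {F : Type u₆}
    [Category.{v₁} A] [Category.{v₂} B] [Category.{v₃} C]
    [Category.{v₄} D] [Category.{v₅} E] [Category.{v₆} F]
    {T : A ⥤ B} {L : A ⥤ C} {R : B ⥤ D} {S : C ⥤ D} {T' : B ⥤ E} {R' : E ⥤ F} {S' : D ⥤ F}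
    (α : TwoSquare T L R S) (β : TwoSquare T' R R' S') :
    TwoSquare.hComp α β = whiskerLeft T β.natTrans ≫ whiskerRight α.natTrans S' :=
  NatTrans.ext (funext fun X => by simp [TwoSquare.hComp])

/-- Vertical composition of 2-squares as a composite of whiskerings. -/
theorem vComp_eq_whiskerRight_comp_whiskerLeft
    {A : Type u₁} {B : Type u₂} {C : Type u₃} {D : Type u₄} {E : Type u₅} {F : Type u₆}
    [Category.{v₁} A] [Category.{v₂} B] [Category.{v₃} C]
    [Category.{v₄} D] [Category.{v₅} E] [Category.{v₆} F]
    {T : A ⥤ B} {L : A ⥤ C} {R : B ⥤ D} {S : C ⥤ D} {L' : C ⥤ E} {R' : D ⥤ F} {S' : E ⥤ F}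
    (α : TwoSquare T L R S) (β : TwoSquare S L' R' S') :
    TwoSquare.vComp α β = whiskerRight α.natTrans R' ≫ whiskerLeft L β.natTrans :=
  NatTrans.ext (funext fun X => by simp [TwoSquare.vComp])

/-- The Kelly–Street double functoriality of the mates correspondence:
the mate of a vertical (resp. horizontal) pasting of squares is the vertical
(resp. horizontal) pasting of the mates. -/
theorem kelly_street_mates_functoriality :
    -- vertical pasting
    (∀ {𝒜 : Type u₁} {ℬ : Type u₂} {𝒞 : Type u₃} {𝒟 : Type u₄} {ℰ : Type u₅} {ℱ : Type u₆}
      [Category.{v₁} 𝒜] [Category.{v₂} ℬ] [Category.{v₃} 𝒞]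
      [Category.{v₄} 𝒟] [Category.{v₅} ℰ] [Category.{v₆} ℱ]
      {H : 𝒜 ⥤ 𝒟} {K : ℬ ⥤ ℰ} {M : 𝒞 ⥤ ℱ}
      {F₁ : 𝒜 ⥤ ℬ} {U₁ : ℬ ⥤ 𝒜} {F₂ : ℬ ⥤ 𝒞} {U₂ : 𝒞 ⥤ ℬ}
      {L₁ : 𝒟 ⥤ ℰ} {R₁ : ℰ ⥤ 𝒟} {L₂ : ℰ ⥤ ℱ} {R₂ : ℱ ⥤ ℰ}
      (adjF₁ : F₁ ⊣ U₁) (adjF₂ : F₂ ⊣ U₂) (adjL₁ : L₁ ⊣ R₁) (adjL₂ : L₂ ⊣ R₂)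
      (α₁ : H ⋙ L₁ ⟶ F₁ ⋙ K) (α₂ : K ⋙ L₂ ⟶ F₂ ⋙ M),
      mateEquiv (G := H) (H := M) (adjF₁.comp adjF₂) (adjL₁.comp adjL₂)
          (whiskerRight α₁ L₂ ≫ whiskerLeft F₁ α₂) =
        whiskerLeft U₂ (mateEquiv adjF₁ adjL₁ α₁) ≫
          whiskerRight (mateEquiv adjF₂ adjL₂ α₂) R₁) ∧
    -- horizontal pasting
    (∀ {𝒜 : Type u₁} {ℬ : Type u₂} {𝒞 : Type u₃} {𝒟 : Type u₄} {ℰ : Type u₅} {ℱ : Type u₆}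
      [Category.{v₁} 𝒜] [Category.{v₂} ℬ] [Category.{v₃} 𝒞]
      [Category.{v₄} 𝒟] [Category.{v₅} ℰ] [Category.{v₆} ℱ]
      {F : 𝒜 ⥤ ℬ} {U : ℬ ⥤ 𝒜} {L : 𝒞 ⥤ 𝒟} {R : 𝒟 ⥤ 𝒞} {G : ℰ ⥤ ℱ} {V : ℱ ⥤ ℰ}
      {H : 𝒜 ⥤ 𝒞} {K : ℬ ⥤ 𝒟} {H' : 𝒞 ⥤ ℰ} {K' : 𝒟 ⥤ ℱ}
      (adjF : F ⊣ U) (adjL : L ⊣ R) (adjG : G ⊣ V)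
      (α : H ⋙ L ⟶ F ⋙ K) (α' : H' ⋙ G ⟶ L ⋙ K'),
      mateEquiv (G := H ⋙ H') (H := K ⋙ K') adjF adjG
          (whiskerLeft H α' ≫ whiskerRight α K') =
        whiskerRight (mateEquiv adjF adjL α) H' ≫
          whiskerLeft K (mateEquiv adjL adjG α')) := by
  refine ⟨?_, ?_⟩
  · intro 𝒜 ℬ 𝒞 𝒟 ℰ ℱ _ _ _ _ _ _ H K M F₁ U₁ F₂ U₂ L₁ R₁ L₂ R₂ adjF₁ adjF₂ adjL₁ adjL₂ α₁ α₂
    exact (congrArg _ (vComp_eq_whiskerRight_comp_whiskerLeft α₁ α₂).symm).trans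
      ((mateEquiv_hcomp adjF₁ adjL₁ adjF₂ adjL₂ α₁ α₂).trans
        (hComp_eq_whiskerLeft_comp_whiskerRight _ _))
  · intro 𝒜 ℬ 𝒞 𝒟 ℰ ℱ _ _ _ _ _ _ F U L R G V H K H' K' adjF adjL adjG α α'
    exact (congrArg _ (hComp_eq_whiskerLeft_comp_whiskerRight α α').symm).trans
      ((mateEquiv_vcomp adjF adjL adjG α α').trans
        (vComp_eq_whiskerRight_comp_whiskerLeft _ _))
end

section
/- Let the commutative square p ∘ q = x ∘ s in 𝓔 (with q : B → A, s : B → Y, x : Y → X, p : A → X) be a pullback square. Then the mate x^* ∘ p_* ⇒ s_* ∘ q^* of the identity 2-cell p_! ∘ q_! = x_! ∘ s_!, obtained by taking mates three times (first with respect to the adjunctions s_! ⊣ s^* and p_! ⊣ p^*, then with respect to q_! ⊣ q^* and x_! ⊣ x^*, then with respect to s^* ⊣ s_* and p^* ⊣ p_*), is a natural isomorphism (the Beck–Chevalley isomorphism for pushforwards). -/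
/-!
Beck–Chevalley for pushforwards: for a pullback square, the threefold mate
`x^* ∘ p_* ⟶ s_* ∘ q^*` of the identity 2-cell `p_! ∘ q_! = x_! ∘ s_!` is a natural
isomorphism.
-/

noncomputable section

open CategoryTheory Category Limits Adjunction

universe v u

/-- A locally cartesian closed structure: every morphism `p` induces a pushforward
(dependent product) functor `p_*` right adjoint to pullback `p^*`. -/
structure LCC (𝓔 : Type u) [Category.{v} 𝓔] [HasPullbacks 𝓔] where
  push : ∀ {A X : 𝓔}, (A ⟶ X) → (Over A ⥤ Over X)
  adj : ∀ {A X : 𝓔} (p : A ⟶ X), Over.pullback p ⊣ push p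

variable {𝓔 : Type u} [Category.{v} 𝓔] [HasPullbacks 𝓔]

/-- The identity 2-cell `p_! ∘ q_! = x_! ∘ s_!` associated to a commutative square
`q ≫ p = s ≫ x`, expressed as a natural isomorphism. -/
def sqCell {B A Y X : 𝓔} (q : B ⟶ A) (s : B ⟶ Y) (x : Y ⟶ X) (p : A ⟶ X)
    (w : q ≫ p = s ≫ x) : Over.map q ⋙ Over.map p ≅ Over.map s ⋙ Over.map x :=
  (Over.mapComp q p).symm ≪≫ eqToIso (by rw [w]) ≪≫ Over.mapComp s x

/-- The first mate `q_! ∘ s^* ⟶ p^* ∘ x_!` of the identity 2-cell. -/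
def bcMate {B A Y X : 𝓔} (q : B ⟶ A) (s : B ⟶ Y) (x : Y ⟶ X) (p : A ⟶ X)
    (w : q ≫ p = s ≫ x) :
    Over.pullback s ⋙ Over.map q ⟶ Over.map x ⋙ Over.pullback p :=
  mateEquiv (Over.mapPullbackAdj s) (Over.mapPullbackAdj p) (sqCell q s x p w).hom

/-- The second mate `s^* ∘ x^* ⟶ q^* ∘ p^*` of the identity 2-cell. -/
def cMate {B A Y X : 𝓔} (q : B ⟶ A) (s : B ⟶ Y) (x : Y ⟶ X) (p : A ⟶ X)
    (w : q ≫ p = s ≫ x) :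
    Over.pullback x ⋙ Over.pullback s ⟶ Over.pullback p ⋙ Over.pullback q :=
  mateEquiv (Over.mapPullbackAdj x) (Over.mapPullbackAdj q) (bcMate q s x p w)

/-- The third mate `x^* ∘ p_* ⟶ s_* ∘ q^*` of the identity 2-cell. -/
def pushMate (E : LCC 𝓔) {B A Y X : 𝓔} (q : B ⟶ A) (s : B ⟶ Y) (x : Y ⟶ X) (p : A ⟶ X)
    (w : q ≫ p = s ≫ x) :
    E.push p ⋙ Over.pullback x ⟶ Over.pullback q ⋙ E.push s :=
  mateEquiv (E.adj p) (E.adj s) (cMate q s x p w)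

lemma sqCell_hom_app_left {𝓒 : Type u} [Category.{v} 𝓒] {B A Y X : 𝓒}
    (q : B ⟶ A) (s : B ⟶ Y) (x : Y ⟶ X) (p : A ⟶ X) (w : q ≫ p = s ≫ x) (Z : Over B) :
    ((sqCell q s x p w).hom.app Z).left = 𝟙 Z.left := by
  simp [sqCell, eqToHom_app, Over.mapComp]

lemma bcMate_app_left_fst {B A Y X : 𝓔} (q : B ⟶ A) (s : B ⟶ Y) (x : Y ⟶ X) (p : A ⟶ X)
    (w : q ≫ p = s ≫ x) (Z : Over Y) :
    ((bcMate q s x p w).app Z).left ≫ pullback.fst (Z.hom ≫ x) p = pullback.fst Z.hom s := by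
  have h := congrArg (fun f => f.left) (mateEquiv_counit (Over.mapPullbackAdj s)
    (Over.mapPullbackAdj p) (sqCell q s x p w).hom Z)
  have hx : ((Over.mapPullbackAdj p).counit.app ((Over.map x).obj Z)).left =
      pullback.fst (Z.hom ≫ x) p := by simp
  have hs : ((Over.mapPullbackAdj s).counit.app Z).left = pullback.fst Z.hom s := by simp
  rw [← hx, ← hs]
  refine h.trans ((congrArg (· ≫ ((Over.mapPullbackAdj s).counit.app Z).left)
    (sqCell_hom_app_left q s x p w ((Over.pullback s).obj Z))).trans (id_comp _))

lemma bcMate_app_left_snd {B A Y X : 𝓔} (q : B ⟶ A) (s : B ⟶ Y) (x : Y ⟶ X) (p : A ⟶ X)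
    (w : q ≫ p = s ≫ x) (Z : Over Y) :
    ((bcMate q s x p w).app Z).left ≫ pullback.snd (Z.hom ≫ x) p =
      pullback.snd Z.hom s ≫ q :=
  Over.w ((bcMate q s x p w).app Z)

lemma isIso_bcMate {B A Y X : 𝓔} (q : B ⟶ A) (s : B ⟶ Y) (x : Y ⟶ X) (p : A ⟶ X)
    (w : q ≫ p = s ≫ x) (sq : IsPullback q s p x) : IsIso (bcMate q s x p w) := by
  refine NatTrans.isIso_iff_isIso_app _ |>.2 fun Z => ?_
  have h : IsPullback (pullback.fst Z.hom s) (pullback.snd Z.hom s ≫ q) (Z.hom ≫ x) p :=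
    ((IsPullback.of_hasPullback Z.hom s).flip.paste_horiz sq).flip
  have e : ((bcMate q s x p w).app Z).left = h.isoPullback.hom := by
    apply pullback.hom_ext
    · exact (bcMate_app_left_fst q s x p w Z).trans h.isoPullback_hom_fst.symm
    · exact (bcMate_app_left_snd q s x p w Z).trans h.isoPullback_hom_snd.symm
  have : IsIso ((Over.forget A).map ((bcMate q s x p w).app Z)) :=
    (congrArg IsIso e).mpr h.isoPullback.isIso_hom
  exact isIso_of_reflects_iso _ (Over.forget A)

/-- If the commutative square `q ≫ p = s ≫ x` is a pullback, then the threefold mate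
`x^* ∘ p_* ⟶ s_* ∘ q^*` of the identity 2-cell `p_! ∘ q_! = x_! ∘ s_!` is a natural
isomorphism (the Beck–Chevalley isomorphism for pushforwards). -/
theorem beck_chevalley_pushforward_iso (E : LCC 𝓔) {B A Y X : 𝓔}
    (q : B ⟶ A) (s : B ⟶ Y) (x : Y ⟶ X) (p : A ⟶ X)
    (w : q ≫ p = s ≫ x) (sq : IsPullback q s p x) :
    IsIso (pushMate E q s x p w) := by
  have := isIso_bcMate q s x p w sq
  have h : pushMate E q s x p w =
      conjugateEquiv ((Over.mapPullbackAdj x).comp (E.adj p))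
        ((E.adj s).comp (Over.mapPullbackAdj q)) (bcMate q s x p w) :=
    iterated_mateEquiv_conjugateEquiv (Over.mapPullbackAdj x) (Over.mapPullbackAdj q)
      (E.adj s) (E.adj p) (bcMate q s x p w)
  rw [h]
  exact conjugateEquiv_iso _ _ _

end
end
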